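/- arXiv:2206.00728 — 4 statements merged into one kernel-verified Lean document; each statement's English description precedes it below -/
import Mathlib

section
/- Fix d ≥ 1 and −d/2 < s < 0. There exist constants c₀ > 0 and c > 0, depending only on d and s, such that for all real R ≥ 1, A ≥ 1, all N ≥ 8A, and all 0 < t ≤ c₀/N, the second Picard iterate satisfies the lower bound ‖Ξ₁(t)‖_{H^s} ≥ c t² R³ A^{2d} A^{d/2+s}. -/
open scoped BigOperators

noncomputable section

/-- Japanese bracket `⟨n⟩ = √(1+|n|²)` for `n ∈ ℤ^d`. -/
def jap {d : ℕ} (n : Fin d → ℤ) : ℝ := Real.sqrt (1 + ∑ i, ((n i : ℝ)) ^ 2)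

/-- Discrete convolution on `ℤ^d`. -/
def dconv {d : ℕ} (f g : (Fin d → ℤ) → ℂ) : (Fin d → ℤ) → ℂ :=
  fun n => ∑' m, f m * g (n - m)

/-- Triple (cubic) convolution. -/
def dcube {d : ℕ} (f : (Fin d → ℤ) → ℂ) : (Fin d → ℤ) → ℂ := dconv (dconv f f) f

/-- The square of the `H^σ` norm of a sequence of Fourier coefficients. -/
def hsum {d : ℕ} (σ : ℝ) (v : (Fin d → ℤ) → ℂ) : ℝ :=
  ∑' n, (jap n) ^ (2 * σ) * ‖v n‖ ^ 2

/-- `m ∈ Q_A = [-A/2, A/2)^d`. -/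
def inQ {d : ℕ} (A : ℝ) (m : Fin d → ℤ) : Prop :=
  ∀ i, -(A / 2) ≤ (m i : ℝ) ∧ (m i : ℝ) < A / 2

/-- The first standard basis vector `e₁ = (1,0,…,0)` of `ℤ^d`. -/
def e1 (d : ℕ) : Fin d → ℤ := fun i => if (i : ℕ) = 0 then 1 else 0

/-- The initial datum `φ₀` with amplitude `R`, supported on the four cubes
`jNe₁ + Q_A`, `j ∈ {-2,-1,1,2}`. -/
def phi0 {d : ℕ} (R A : ℝ) (N : ℤ) : (Fin d → ℤ) → ℂ :=
  Set.indicator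
    {n : Fin d → ℤ | ∃ j : ℤ, (j = -2 ∨ j = -1 ∨ j = 1 ∨ j = 2) ∧
      inQ A (fun i => n i - j * N * e1 d i)}
    (fun _ => (R : ℂ))

/-- The free wave evolution of the data `(φ₀, φ₁) = (φ₀, N·φ₀)`. -/
def zfree {d : ℕ} (R A : ℝ) (N : ℤ) (t : ℝ) : (Fin d → ℤ) → ℂ :=
  fun n => (Real.cos (t * jap n) : ℂ) * phi0 R A N n
    + ((Real.sin (t * jap n) / jap n : ℝ) : ℂ) * ((N : ℂ) * phi0 R A N n)

/-- The second Picard iterate `Ξ₁`. -/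
def Xi1 {d : ℕ} (R A : ℝ) (N : ℤ) (t : ℝ) : (Fin d → ℤ) → ℂ :=
  fun n => -∫ s in (0 : ℝ)..t,
    ((Real.sin ((t - s) * jap n) / jap n : ℝ) : ℂ) * dcube (zfree R A N s) n

end

/-- The lattice cube `[-K, K]^d`. -/
noncomputable def latticeBox (d K : ℕ) : Finset (Fin d → ℤ) :=
  Fintype.piFinset fun _ => Finset.Icc (-(K : ℤ)) K

/-- The real amplitude of the free evolution: `zfree` is its complexification. -/
noncomputable def zreal {d : ℕ} (R A : ℝ) (N : ℤ) (t : ℝ) (n : Fin d → ℤ) : ℝ :=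
  (Real.cos (t * jap n) + Real.sin (t * jap n) / jap n * N) * (phi0 R A N n).re

/-- The cubic convolution of `g`, for `g` supported in `latticeBox d M`, as a finite sum. -/
noncomputable def finCube {d : ℕ} (M : ℕ) (g : (Fin d → ℤ) → ℝ) (n : Fin d → ℤ) : ℝ :=
  ∑ m ∈ latticeBox d (M + M), (∑ k ∈ latticeBox d M, g k * g (m - k)) * g (n - m)

section LatticeBox

variable {d : ℕ}

lemma mem_latticeBox {K : ℕ} {n : Fin d → ℤ} :
    n ∈ latticeBox d K ↔ ∀ i, |n i| ≤ K := by
  simp [latticeBox, Fintype.mem_piFinset, abs_le]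

lemma card_latticeBox (K : ℕ) : (latticeBox d K).card = (2 * K + 1) ^ d := by
  simp only [latticeBox, Fintype.card_piFinset, Int.card_Icc, Finset.prod_const,
    Finset.card_univ, Fintype.card_fin]
  congr 1
  omega

lemma add_mem_latticeBox {K L : ℕ} {m n : Fin d → ℤ}
    (hm : m ∈ latticeBox d K) (hn : n ∈ latticeBox d L) : m + n ∈ latticeBox d (K + L) := by
  rw [mem_latticeBox] at *
  intro i
  push_cast
  exact (abs_add_le _ _).trans (add_le_add (hm i) (hn i))

lemma le_card_latticeBox_floor (x : ℝ) (hx : 0 ≤ x) :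
    x ^ d ≤ ((latticeBox d ⌊x⌋₊).card : ℝ) := by
  rw [card_latticeBox]
  push_cast
  refine pow_le_pow_left₀ hx ?_ d
  have := (Nat.lt_floor_add_one x).le
  have : (0 : ℝ) ≤ (⌊x⌋₊ : ℝ) := by positivity
  linarith

lemma jap_pos (n : Fin d → ℤ) : 0 < jap n :=
  Real.sqrt_pos.2 (by positivity)

lemma jap_le {K : ℝ} (hK : 1 ≤ K) {n : Fin d → ℤ} (hn : ∀ i, |(n i : ℝ)| ≤ K) :
    jap n ≤ (1 + d) * K := by
  refine Real.sqrt_le_iff.2 ⟨by positivity, ?_⟩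
  have h : ∑ i, ((n i : ℝ)) ^ 2 ≤ d * K ^ 2 := by
    calc ∑ i, ((n i : ℝ)) ^ 2 ≤ ∑ _i : Fin d, K ^ 2 :=
          Finset.sum_le_sum fun i _ => sq_le_sq' (abs_le.1 (hn i)).1 (abs_le.1 (hn i)).2
      _ = d * K ^ 2 := by simp
  have hd : (0 : ℝ) ≤ d := by positivity
  have h1 : (1 : ℝ) ≤ K ^ 2 := one_le_pow₀ hK
  nlinarith [mul_nonneg hd (sq_nonneg K), mul_nonneg (mul_nonneg hd hd) (sq_nonneg K)]

end LatticeBox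

section Convolution

variable {d : ℕ}

lemma dconv_eq_sum {M : ℕ} {f : (Fin d → ℤ) → ℂ} (hf : ∀ n ∉ latticeBox d M, f n = 0)
    (g : (Fin d → ℤ) → ℂ) (n : Fin d → ℤ) :
    dconv f g n = ∑ m ∈ latticeBox d M, f m * g (n - m) :=
  tsum_eq_sum fun m hm => by rw [hf m hm, zero_mul]

lemma dconv_eq_zero {M L : ℕ} {f g : (Fin d → ℤ) → ℂ}
    (hf : ∀ n ∉ latticeBox d M, f n = 0) (hg : ∀ n ∉ latticeBox d L, g n = 0)
    {n : Fin d → ℤ} (hn : n ∉ latticeBox d (M + L)) : dconv f g n = 0 := by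
  rw [dconv_eq_sum hf]
  refine Finset.sum_eq_zero fun m hm => ?_
  rw [hg, mul_zero]
  intro h
  exact hn (by simpa using add_mem_latticeBox hm h)

lemma dcube_eq_zero {M : ℕ} {f : (Fin d → ℤ) → ℂ} (hf : ∀ n ∉ latticeBox d M, f n = 0)
    {n : Fin d → ℤ} (hn : n ∉ latticeBox d (M + M + M)) : dcube f n = 0 :=
  dconv_eq_zero (fun _ h => dconv_eq_zero hf hf h) hf hn

lemma dcube_ofReal {M : ℕ} {g : (Fin d → ℤ) → ℝ} (hg : ∀ n ∉ latticeBox d M, g n = 0)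
    (n : Fin d → ℤ) : dcube (fun k => (g k : ℂ)) n = (finCube M g n : ℝ) := by
  have hf : ∀ n ∉ latticeBox d M, ((g n : ℝ) : ℂ) = 0 := fun n hn => by simp [hg n hn]
  have hff : ∀ n ∉ latticeBox d (M + M),
      dconv (fun k => (g k : ℂ)) (fun k => (g k : ℂ)) n = 0 :=
    fun n hn => dconv_eq_zero hf hf hn
  rw [dcube, dconv_eq_sum hff]
  simp only [dconv_eq_sum hf, finCube]
  push_cast
  rfl

/-- A nonnegative sequence bounded below by `r` on the translates of a cube by `v`, `v` and `-2v`
has a large cubic convolution on a smaller cube. -/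
lemma finCube_lower_bound {M K : ℕ} {g : (Fin d → ℤ) → ℝ}
    (hg : ∀ n ∉ latticeBox d M, g n = 0) (hg0 : ∀ n, 0 ≤ g n) {r : ℝ} (hr : 0 < r)
    (v : Fin d → ℤ) (h1 : ∀ p ∈ latticeBox d (K + K), r ≤ g (v + p))
    (h2 : ∀ p ∈ latticeBox d (K + K), r ≤ g (-(v + v) + p))
    {n : Fin d → ℤ} (hn : n ∈ latticeBox d K) :
    ((latticeBox d K).card : ℝ) ^ 2 * r ^ 3 ≤ finCube M g n := by
  have hmem : ∀ w, r ≤ g w → w ∈ latticeBox d M := fun w hw => by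
    by_contra h
    exact absurd (hg w h) (hr.trans_le hw).ne'
  have hneg : ∀ p ∈ latticeBox d K, -p ∈ latticeBox d K := fun p hp => by
    rw [mem_latticeBox] at *
    simpa using hp
  have hz : (0 : Fin d → ℤ) ∈ latticeBox d K := by simp [mem_latticeBox]
  have hdiff : ∀ p ∈ latticeBox d K, ∀ q ∈ latticeBox d K,
      p - q ∈ latticeBox d (K + K) := fun p hp q hq => by
    rw [sub_eq_add_neg]
    exact add_mem_latticeBox hp (hneg q hq)
  have hsub : ∀ p ∈ latticeBox d K, p ∈ latticeBox d (K + K) := fun p hp => by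
    simpa using add_mem_latticeBox hp hz
  have inner : ∀ p ∈ latticeBox d K, ((latticeBox d K).card : ℝ) * r ^ 2 ≤
      ∑ k ∈ latticeBox d M, g k * g (v + v + p - k) := by
    intro p hp
    calc ((latticeBox d K).card : ℝ) * r ^ 2
        = ∑ _q ∈ latticeBox d K, r ^ 2 := by simp
      _ ≤ ∑ q ∈ latticeBox d K, g (v + q) * g (v + v + p - (v + q)) := by
          refine Finset.sum_le_sum fun q hq => ?_
          rw [show v + v + p - (v + q) = v + (p - q) by abel, sq]
          exact mul_le_mul (h1 q (hsub q hq)) (h1 _ (hdiff p hp q hq)) hr.le (hg0 _)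
      _ = ∑ k ∈ (latticeBox d K).map (addLeftEmbedding v), g k * g (v + v + p - k) := by
          simp
      _ ≤ _ := by
          refine Finset.sum_le_sum_of_subset_of_nonneg ?_
            fun k _ _ => mul_nonneg (hg0 _) (hg0 _)
          intro k hk
          obtain ⟨q, hq, rfl⟩ := Finset.mem_map.1 hk
          exact hmem _ (h1 q (hsub q hq))
  calc ((latticeBox d K).card : ℝ) ^ 2 * r ^ 3
      = ∑ _p ∈ latticeBox d K, ((latticeBox d K).card : ℝ) * r ^ 2 * r := by simp; ring
    _ ≤ ∑ p ∈ latticeBox d K, (∑ k ∈ latticeBox d M, g k * g (v + v + p - k)) *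
          g (n - (v + v + p)) := by
        refine Finset.sum_le_sum fun p hp => ?_
        rw [show n - (v + v + p) = -(v + v) + (n - p) by abel]
        exact mul_le_mul (inner p hp) (h2 _ (hdiff n hn p hp)) hr.le
          (Finset.sum_nonneg fun k _ => mul_nonneg (hg0 _) (hg0 _))
    _ = ∑ m ∈ (latticeBox d K).map (addLeftEmbedding (v + v)),
          (∑ k ∈ latticeBox d M, g k * g (m - k)) * g (n - m) := by simp
    _ ≤ _ := by
        refine Finset.sum_le_sum_of_subset_of_nonneg ?_ fun m _ _ =>
          mul_nonneg (Finset.sum_nonneg fun k _ => mul_nonneg (hg0 _) (hg0 _)) (hg0 _)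
        intro m hm
        obtain ⟨p, hp, rfl⟩ := Finset.mem_map.1 hm
        have e : addLeftEmbedding (v + v) p = v + (v + p) := by simp [add_assoc]
        rw [e]
        exact add_mem_latticeBox (by simpa using hmem _ (h1 0 (hsub 0 hz)))
          (hmem _ (h1 p (hsub p hp)))

end Convolution

section InitialData

variable {d : ℕ} {R A : ℝ} {N : ℤ}

lemma phi0_eq_ofReal_re (n : Fin d → ℤ) : phi0 R A N n = ((phi0 R A N n).re : ℂ) := by
  unfold phi0 Set.indicator
  split_ifs <;> simp

lemma phi0_re_nonneg (hR : 0 ≤ R) (n : Fin d → ℤ) : 0 ≤ (phi0 R A N n).re := by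
  unfold phi0 Set.indicator
  split_ifs <;> simp [hR]

lemma phi0_re_translate {j : ℤ} (hj : j = -2 ∨ j = -1 ∨ j = 1 ∨ j = 2)
    {v p : Fin d → ℤ} (hv : ∀ i, v i = j * N * e1 d i) (hp : inQ A p) :
    (phi0 R A N (v + p)).re = R := by
  have h : v + p ∈ {n : Fin d → ℤ | ∃ j : ℤ, (j = -2 ∨ j = -1 ∨ j = 1 ∨ j = 2) ∧
      inQ A (fun i => n i - j * N * e1 d i)} := by
    refine ⟨j, hj, ?_⟩
    convert hp using 2 with i
    simp [hv]
  rw [phi0, Set.indicator_of_mem h, Complex.ofReal_re]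

lemma abs_le_of_phi0_re_ne_zero (hA : 1 ≤ A) (hN : 8 * A ≤ N) {n : Fin d → ℤ}
    (hn : (phi0 R A N n).re ≠ 0) (i : Fin d) : |n i| ≤ 3 * N := by
  have h : n ∈ {n : Fin d → ℤ | ∃ j : ℤ, (j = -2 ∨ j = -1 ∨ j = 1 ∨ j = 2) ∧
      inQ A (fun i => n i - j * N * e1 d i)} := by
    by_contra h
    exact hn (by rw [phi0, Set.indicator_of_notMem h, Complex.zero_re])
  obtain ⟨j, hj, hq⟩ := h
  have hqi := hq i
  have he : e1 d i = 0 ∨ e1 d i = 1 := by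
    unfold e1
    split_ifs <;> simp
  have : |(n i : ℝ)| ≤ 3 * N := by
    rw [abs_le]
    push_cast at hqi
    rcases he with he | he <;> rcases hj with rfl | rfl | rfl | rfl <;>
      simp only [he] at hqi <;> push_cast at hqi <;> constructor <;> linarith
  exact_mod_cast this

lemma zfree_eq_ofReal (t : ℝ) :
    zfree (d := d) R A N t = fun n => (zreal R A N t n : ℂ) := by
  funext n
  rw [zfree, zreal, phi0_eq_ofReal_re]
  push_cast
  simp only [Complex.ofReal_re]
  ring

lemma continuous_zreal (n : Fin d → ℤ) : Continuous fun t => zreal R A N t n := by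
  unfold zreal
  fun_prop

lemma zreal_eq_zero (hA : 1 ≤ A) (hN : 8 * A ≤ N) (t : ℝ) {n : Fin d → ℤ}
    (hn : n ∉ latticeBox d (3 * N).toNat) : zreal R A N t n = 0 := by
  have h : (phi0 R A N n).re = 0 := by
    by_contra h
    refine hn (mem_latticeBox.2 fun i => ?_)
    exact (abs_le_of_phi0_re_ne_zero hA hN h i).trans (Int.self_le_toNat _)
  simp [zreal, h]

lemma half_phi0_re_le_zreal (hR : 0 ≤ R) (hA : 1 ≤ A) (hN : 8 * A ≤ N) {t : ℝ} (ht : 0 ≤ t)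
    (htN : t * (3 * (1 + d) * N) ≤ 1) (n : Fin d → ℤ) :
    (phi0 R A N n).re / 2 ≤ zreal R A N t n := by
  by_cases h : (phi0 R A N n).re = 0
  · simp [zreal, h]
  have hj : jap n ≤ (1 + d) * (3 * N) := jap_le (by linarith) fun i => by
    exact_mod_cast abs_le_of_phi0_re_ne_zero hA hN h i
  have hx1 : t * jap n ≤ 1 :=
    (mul_le_mul_of_nonneg_left hj ht).trans (by linarith)
  have hx0 : 0 ≤ t * jap n := mul_nonneg ht (jap_pos n).le
  have hcos := Real.one_sub_sq_div_two_le_cos (x := t * jap n)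
  have hsin : 0 ≤ Real.sin (t * jap n) :=
    Real.sin_nonneg_of_nonneg_of_le_pi hx0 (by linarith [Real.pi_gt_three])
  have hN0 : (0 : ℝ) ≤ N := by linarith
  have hterm : 0 ≤ Real.sin (t * jap n) / jap n * N :=
    mul_nonneg (div_nonneg hsin (jap_pos n).le) hN0
  have hfac : 1 / 2 ≤ Real.cos (t * jap n) + Real.sin (t * jap n) / jap n * N := by nlinarith
  calc (phi0 R A N n).re / 2 = 1 / 2 * (phi0 R A N n).re := by ring
    _ ≤ _ := mul_le_mul_of_nonneg_right hfac (phi0_re_nonneg hR n)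

lemma inQ_of_mem_latticeBox (hA : 1 ≤ A) {p : Fin d → ℤ}
    (hp : p ∈ latticeBox d (⌊A / 8⌋₊ + ⌊A / 8⌋₊)) : inQ A p := by
  intro i
  have h := mem_latticeBox.1 hp i
  have h' : |(p i : ℝ)| ≤ ⌊A / 8⌋₊ + ⌊A / 8⌋₊ := by exact_mod_cast h
  have hf : (⌊A / 8⌋₊ : ℝ) ≤ A / 8 := Nat.floor_le (by linarith)
  have := abs_le.1 h'
  constructor <;> linarith

lemma le_finCube_zreal (hR : 0 < R) (hA : 1 ≤ A) (hN : 8 * A ≤ N) {t : ℝ} (ht : 0 ≤ t)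
    (htN : t * (3 * (1 + d) * N) ≤ 1) {n : Fin d → ℤ} (hn : n ∈ latticeBox d ⌊A / 8⌋₊) :
    ((latticeBox d ⌊A / 8⌋₊).card : ℝ) ^ 2 * (R / 2) ^ 3 ≤
      finCube (3 * N).toNat (zreal R A N t) n := by
  have hz := half_phi0_re_le_zreal (d := d) hR.le hA hN ht htN
  refine finCube_lower_bound (fun n hn => zreal_eq_zero hA hN t hn)
    (fun n => (by linarith [phi0_re_nonneg (A := A) (N := N) hR.le n] : (0 : ℝ) ≤
      (phi0 R A N n).re / 2).trans (hz n)) (by positivity) (fun i => N * e1 d i) ?_ ?_ hn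
  · intro p hp
    have h := hz ((fun i => N * e1 d i) + p)
    rwa [phi0_re_translate (j := 1) (by simp) (fun i => by ring)
      (inQ_of_mem_latticeBox hA hp)] at h
  · intro p hp
    have h := hz (-((fun i => N * e1 d i) + fun i => N * e1 d i) + p)
    rwa [phi0_re_translate (j := -2) (by simp)
      (fun i => by simp only [Pi.neg_apply, Pi.add_apply]; ring)
      (inQ_of_mem_latticeBox hA hp)] at h

end InitialData

section PicardIterate

variable {d : ℕ} {R A : ℝ} {N : ℤ}

lemma Xi1_eq_ofReal (hA : 1 ≤ A) (hN : 8 * A ≤ N) (t : ℝ) (n : Fin d → ℤ) :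
    Xi1 R A N t n = ((-∫ s in (0 : ℝ)..t, Real.sin ((t - s) * jap n) / jap n *
      finCube (3 * N).toNat (zreal R A N s) n : ℝ) : ℂ) := by
  rw [Xi1, Complex.ofReal_neg, ← intervalIntegral.integral_ofReal]
  congr 1
  refine intervalIntegral.integral_congr fun s _ => ?_
  simp only [zfree_eq_ofReal]
  rw [dcube_ofReal (fun n hn => zreal_eq_zero hA hN s hn)]
  push_cast
  rfl

lemma Xi1_eq_zero (hA : 1 ≤ A) (hN : 8 * A ≤ N) (t : ℝ) {n : Fin d → ℤ}
    (hn : n ∉ latticeBox d ((3 * N).toNat + (3 * N).toNat + (3 * N).toNat)) :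
    Xi1 R A N t n = 0 := by
  have h : ∀ s, dcube (zfree R A N s) n = 0 := fun s => by
    rw [zfree_eq_ofReal]
    exact dcube_eq_zero (fun n hn => by simp [zreal_eq_zero hA hN s hn]) hn
  simp [Xi1, h]

lemma half_mul_le_sin {x : ℝ} (h0 : 0 ≤ x) (h1 : x ≤ 1) : x / 2 ≤ Real.sin x := by
  have h := Real.mul_le_sin h0 (by linarith [Real.pi_gt_three])
  have hpi : 1 / 2 ≤ 2 / Real.pi := by
    rw [div_le_div_iff₀ two_pos Real.pi_pos]
    linarith [Real.pi_le_four]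
  nlinarith

lemma abs_le_of_mem_latticeBox_floor {x : ℝ} (hx : 0 ≤ x) {n : Fin d → ℤ}
    (hn : n ∈ latticeBox d ⌊x⌋₊) (i : Fin d) : |(n i : ℝ)| ≤ x := by
  have h : |(n i : ℝ)| ≤ ⌊x⌋₊ := by exact_mod_cast mem_latticeBox.1 hn i
  exact h.trans (Nat.floor_le hx)

lemma jap_le_of_mem_latticeBox (hA : 1 ≤ A) {n : Fin d → ℤ}
    (hn : n ∈ latticeBox d ⌊A / 8⌋₊) : jap n ≤ (1 + d) * A :=
  jap_le hA fun i => (abs_le_of_mem_latticeBox_floor (by linarith) hn i).trans (by linarith)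

lemma le_norm_Xi1 (hR : 0 < R) (hA : 1 ≤ A) (hN : 8 * A ≤ N) {t : ℝ} (ht : 0 ≤ t)
    (htN : t * (3 * (1 + d) * N) ≤ 1) {n : Fin d → ℤ} (hn : n ∈ latticeBox d ⌊A / 8⌋₊) :
    t ^ 2 / 4 * (((A / 8) ^ d) ^ 2 * (R / 2) ^ 3) ≤ ‖Xi1 R A N t n‖ := by
  set C : ℝ := ((latticeBox d ⌊A / 8⌋₊).card : ℝ) ^ 2 * (R / 2) ^ 3 with hC
  have hC0 : 0 ≤ C := by positivity
  have hAC : ((A / 8) ^ d) ^ 2 * (R / 2) ^ 3 ≤ C := by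
    have := le_card_latticeBox_floor (d := d) (A / 8) (by linarith)
    rw [hC]
    gcongr
  have hJ : jap n ≤ 3 * (1 + d) * N := (jap_le_of_mem_latticeBox hA hn).trans (by
    have : (0 : ℝ) ≤ 1 + d := by positivity
    nlinarith)
  have hJN : 0 ≤ 3 * (1 + (d : ℝ)) * N := (jap_pos n).le.trans hJ
  have hcont : Continuous fun s => finCube (3 * N).toNat (zreal R A N s) n := by
    unfold finCube
    have := continuous_zreal (d := d) (R := R) (A := A) (N := N)
    fun_prop
  have hint : ∫ s in (0 : ℝ)..t, (t - s) / 2 * C = t ^ 2 / 4 * C := by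
    rw [intervalIntegral.integral_mul_const, intervalIntegral.integral_div,
      intervalIntegral.integral_sub (by simp) (by simp)]
    simp only [intervalIntegral.integral_const, integral_id, smul_eq_mul]
    ring
  have hle : t ^ 2 / 4 * C ≤ ∫ s in (0 : ℝ)..t, Real.sin ((t - s) * jap n) / jap n *
      finCube (3 * N).toNat (zreal R A N s) n := by
    rw [← hint]
    refine intervalIntegral.integral_mono_on ht
      (Continuous.intervalIntegrable (by fun_prop) _ _)
      (Continuous.intervalIntegrable (by fun_prop) _ _) fun s hs => ?_
    have hs0 : 0 ≤ t - s := by linarith [hs.2]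
    have hx1 : (t - s) * jap n ≤ 1 :=
      (mul_le_mul (by linarith [hs.1] : t - s ≤ t) hJ (jap_pos n).le ht).trans htN
    have hsin : (t - s) / 2 ≤ Real.sin ((t - s) * jap n) / jap n := by
      rw [le_div_iff₀ (jap_pos n)]
      have := half_mul_le_sin (mul_nonneg hs0 (jap_pos n).le) hx1
      linarith
    refine mul_le_mul hsin (le_finCube_zreal hR hA hN hs.1 ?_ hn) hC0 ?_
    · exact (mul_le_mul_of_nonneg_right hs.2 hJN).trans htN
    · exact (by linarith : (0 : ℝ) ≤ (t - s) / 2).trans hsin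
  rw [Xi1_eq_ofReal hA hN, Complex.norm_real, norm_neg]
  exact (mul_le_mul_of_nonneg_left hAC (by positivity)).trans (hle.trans (Real.le_norm_self _))

lemma le_hsum_Xi1 {σ : ℝ} (hσ : σ ≤ 0) (hR : 0 < R) (hA : 1 ≤ A) (hN : 8 * A ≤ N) {t : ℝ}
    (ht : 0 ≤ t) (htN : t * (3 * (1 + d) * N) ≤ 1) :
    (A / 8) ^ d * (((1 + d) * A) ^ (2 * σ) *
      (t ^ 2 / 4 * (((A / 8) ^ d) ^ 2 * (R / 2) ^ 3)) ^ 2) ≤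
      hsum σ (Xi1 (d := d) R A N t) := by
  have hsummable : Summable fun n : Fin d → ℤ => jap n ^ (2 * σ) * ‖Xi1 R A N t n‖ ^ 2 :=
    summable_of_ne_finset_zero fun n hn => by
      rw [Xi1_eq_zero hA hN t hn]
      simp
  have hnonneg : ∀ n : Fin d → ℤ, 0 ≤ jap n ^ (2 * σ) * ‖Xi1 R A N t n‖ ^ 2 := fun n =>
    mul_nonneg (Real.rpow_nonneg (jap_pos n).le _) (sq_nonneg _)
  refine le_trans ?_ (hsummable.sum_le_tsum (latticeBox d ⌊A / 8⌋₊) fun n _ => hnonneg n)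
  calc _ ≤ ((latticeBox d ⌊A / 8⌋₊).card : ℝ) * (((1 + d) * A) ^ (2 * σ) *
      (t ^ 2 / 4 * (((A / 8) ^ d) ^ 2 * (R / 2) ^ 3)) ^ 2) :=
        mul_le_mul_of_nonneg_right (le_card_latticeBox_floor _ (by linarith)) (by positivity)
    _ = ∑ _n ∈ latticeBox d ⌊A / 8⌋₊, ((1 + d) * A) ^ (2 * σ) *
      (t ^ 2 / 4 * (((A / 8) ^ d) ^ 2 * (R / 2) ^ 3)) ^ 2 := by simp
    _ ≤ _ := by
        refine Finset.sum_le_sum fun n hn => ?_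
        refine mul_le_mul ?_ ?_ (by positivity) (Real.rpow_nonneg (jap_pos n).le _)
        · exact Real.rpow_le_rpow_of_nonpos (jap_pos n) (jap_le_of_mem_latticeBox hA hn)
            (by linarith)
        · have := le_norm_Xi1 hR hA hN ht htN hn
          gcongr

end PicardIterate

/-- Lower bound `‖Ξ₁(t)‖_{H^s} ≳ t² R³ A^{2d} A^{d/2+s}` for `-d/2 < s < 0`,
valid for `R, A ≥ 1`, `N ≥ 8A` and `0 < t ≤ c₀/N`. -/
theorem Xi1_lower_bound (d : ℕ) (hd : 1 ≤ d) (s : ℝ)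
    (hs1 : -(d : ℝ) / 2 < s) (hs2 : s < 0) :
    ∃ c₀ > (0 : ℝ), ∃ c > (0 : ℝ), ∀ R A : ℝ, 1 ≤ R → 1 ≤ A →
      ∀ N : ℤ, 8 * A ≤ (N : ℝ) →
      ∀ t : ℝ, 0 < t → t ≤ c₀ / (N : ℝ) →
        c * t ^ 2 * R ^ 3 * A ^ (2 * (d : ℝ)) * A ^ ((d : ℝ) / 2 + s)
          ≤ Real.sqrt (hsum s (Xi1 (d := d) R A N t)) := by
  refine ⟨1 / (3 * (1 + d)), by positivity,
    1 / 32 * ((1 / 8) ^ d) ^ 2 * Real.sqrt ((1 / 8) ^ d) * (1 + d) ^ s, by positivity, ?_⟩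
  intro R A hR hA N hN t ht htc
  have hN0 : (0 : ℝ) < N := by linarith
  have hA0 : 0 < A := by linarith
  have htN : t * (3 * (1 + d) * N) ≤ 1 := by
    rw [div_div, le_div_iff₀ (by positivity)] at htc
    exact htc
  refine Real.le_sqrt_of_sq_le (le_trans (le_of_eq ?_)
    (le_hsum_Xi1 hs2.le (by linarith) hA hN ht.le htN))
  have hA_sq : A ^ (2 * (d : ℝ)) = (A ^ d) ^ 2 := by
    rw [mul_comm, Real.rpow_mul hA0.le, Real.rpow_natCast, Real.rpow_two]
  have hA_half : (A ^ ((d : ℝ) / 2 + s)) ^ 2 = A ^ d * (A ^ s) ^ 2 := by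
    rw [Real.rpow_add hA0, mul_pow]
    congr 1
    rw [← Real.rpow_natCast (A ^ ((d : ℝ) / 2)), ← Real.rpow_mul hA0.le, ← Real.rpow_natCast]
    congr 1
    push_cast
    ring
  have h_weight : (((1 : ℝ) + d) * A) ^ (2 * s) = ((1 + d) ^ s) ^ 2 * (A ^ s) ^ 2 := by
    rw [mul_comm 2 s, Real.rpow_mul (by positivity), Real.rpow_two,
      Real.mul_rpow (by positivity) hA0.le, mul_pow]
  have h_count : (A / 8) ^ d = A ^ d * (1 / 8) ^ d := by
    rw [← mul_pow]
    congr 1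
    ring
  have h_sqrt : Real.sqrt ((1 / 8 : ℝ) ^ d) ^ 2 = (1 / 8) ^ d := Real.sq_sqrt (by positivity)
  rw [mul_pow _ (A ^ ((d : ℝ) / 2 + s)), hA_sq, hA_half, h_weight, h_count]
  simp only [mul_pow, h_sqrt]
  ring
end

section
/- For every t, x ∈ ℝ, the series Σ_{k=0}^∞ (t^k / k!) · H_k(x) has sum exp(t·x − t²/2); that is, the generating function identity e^{tx − t²/2} = Σ_{k≥0} (t^k/k!) H_k(x) holds with the series converging in the sense of HasSum. -/
namespace Polynomial

/-- The derivatives in `s` of the generating function of the Hermite polynomials. -/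
theorem iteratedDeriv_cexp_mul_sub_sq_div_two (n : ℕ) (z : ℂ) :
    iteratedDeriv n (fun s : ℂ => Complex.exp (s * z - s ^ 2 / 2)) =
      fun s => aeval (z - s) (hermite n) * Complex.exp (s * z - s ^ 2 / 2) := by
  induction n with
  | zero => simp
  | succ n ih =>
    rw [iteratedDeriv_succ, ih]
    funext s
    have h_exp : HasDerivAt (fun s : ℂ => Complex.exp (s * z - s ^ 2 / 2))
        (Complex.exp (s * z - s ^ 2 / 2) * (1 * z - (2 : ℕ) * s ^ (2 - 1) / 2)) s :=
      (((hasDerivAt_id s).mul_const z).sub ((hasDerivAt_pow 2 s).div_const 2)).cexp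
    have h_hermite : HasDerivAt (fun s : ℂ => aeval (z - s) (hermite n))
        (aeval (z - s) (derivative (hermite n)) * -1) s :=
      ((hermite n).hasDerivAt_aeval (z - s)).comp s ((hasDerivAt_id s).const_sub z)
    rw [(h_hermite.fun_mul h_exp).deriv, hermite_succ, map_sub, map_mul, aeval_X]
    push_cast
    ring

/-- Generating function of the Hermite polynomials over `ℂ`. -/
theorem hasSum_hermite_cexp (t z : ℂ) :
    HasSum (fun k : ℕ => t ^ k / (Nat.factorial k : ℂ) * aeval z (hermite k))
      (Complex.exp (t * z - t ^ 2 / 2)) := by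
  have hf : Differentiable ℂ fun s : ℂ => Complex.exp (s * z - s ^ 2 / 2) := by fun_prop
  refine (Complex.hasSum_taylorSeries_of_entire hf 0 t).congr_fun fun k => ?_
  simp only [iteratedDeriv_cexp_mul_sub_sq_div_two, smul_eq_mul, sub_zero, zero_mul,
    ne_eq, OfNat.ofNat_ne_zero, not_false_eq_true, zero_pow, zero_div, Complex.exp_zero]
  ring

end Polynomial

/-- Generating function of the probabilists' Hermite polynomials:
`e^{tx - t²/2} = Σ_{k≥0} (t^k/k!) H_k(x)`. -/
theorem hermite_generating_function (t x : ℝ) :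
    HasSum (fun k : ℕ => t ^ k / (Nat.factorial k : ℝ) *
        (Polynomial.aeval x (Polynomial.hermite k)))
      (Real.exp (t * x - t ^ 2 / 2)) := by
  rw [← Complex.hasSum_ofReal]
  have h_cast (p : Polynomial ℤ) :
      Polynomial.aeval (x : ℂ) p = ((Polynomial.aeval x p : ℝ) : ℂ) :=
    Polynomial.aeval_algebraMap_apply ℂ x p
  simpa [h_cast] using Polynomial.hasSum_hermite_cexp t x
end

section
/- For all k, m ∈ ℕ, ∫_ℝ H_k(x) · H_m(x) dγ(x) = k! if k = m and 0 otherwise, where γ is the standard Gaussian measure on ℝ. -/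
open MeasureTheory ProbabilityTheory

theorem integrable_aeval_gaussianReal {R : Type*} [CommSemiring R] [Algebra R ℝ]
    (μ : ℝ) (v : NNReal) (p : Polynomial R) :
    Integrable (fun x : ℝ => Polynomial.aeval x p) (gaussianReal μ v) := by
  simp only [Polynomial.aeval_eq_sum_range]
  refine integrable_finsetSum _ fun i _ => ?_
  have h : Integrable (fun x : ℝ => x ^ i) (gaussianReal μ v) := by
    have h := (memLp_id_gaussianReal (μ := μ) (v := v) (i : NNReal)).integrable_norm_pow'
    refine (integrable_norm_iff (by fun_prop)).mp ?_
    simpa using h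
  simpa only [Algebra.smul_def] using h.const_mul _

theorem hasDerivAt_gaussianPDFReal_zero_one (x : ℝ) :
    HasDerivAt (gaussianPDFReal 0 1) (-x * gaussianPDFReal 0 1 x) x := by
  have h : HasDerivAt (fun y : ℝ => -(y - 0) ^ 2 / (2 * ((1 : NNReal) : ℝ))) (-x) x := by
    convert! (((hasDerivAt_id x).sub_const 0).pow 2).neg.div_const (2 * ((1 : NNReal) : ℝ)) using 1
    simp
    ring
  convert! h.exp.const_mul (√(2 * Real.pi * (1 : NNReal)))⁻¹ using 1
  rw [gaussianPDFReal]
  ring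

/-- The Stein identity for polynomials. -/
theorem integral_mul_aeval_gaussianReal_zero_one {R : Type*} [CommSemiring R] [Algebra R ℝ]
    (p : Polynomial R) :
    ∫ x : ℝ, x * Polynomial.aeval x p ∂(gaussianReal 0 1) =
      ∫ x : ℝ, Polynomial.aeval x (Polynomial.derivative p) ∂(gaussianReal 0 1) := by
  have hint (q : Polynomial R) :
      Integrable (fun x : ℝ => Polynomial.aeval x q * gaussianPDFReal 0 1 x) := by
    have h := integrable_aeval_gaussianReal 0 1 q
    rw [gaussianReal_of_var_ne_zero 0 one_ne_zero, integrable_withDensity_iff_integrable_smul'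
      (measurable_gaussianPDF 0 1) (ae_of_all _ fun _ => gaussianPDF_lt_top)] at h
    simpa only [toReal_gaussianPDF, smul_eq_mul, mul_comm] using h
  simp only [integral_gaussianReal_eq_integral_smul one_ne_zero, smul_eq_mul]
  have h := integral_mul_deriv_eq_deriv_mul_of_integrable
    (fun x _ => p.hasDerivAt_aeval x) (fun x _ => hasDerivAt_gaussianPDFReal_zero_one x)
    ?_ (hint _) (hint _)
  · simp only [neg_mul, mul_neg, integral_neg, neg_inj] at h
    simpa only [mul_comm, mul_left_comm, mul_assoc] using h
  · convert! (hint (Polynomial.X * p)).neg using 1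
    ext x
    simp
    ring

theorem derivative_hermite_succ (n : ℕ) :
    Polynomial.derivative (Polynomial.hermite (n + 1)) =
      ((n + 1 : ℕ) : Polynomial ℤ) * Polynomial.hermite n := by
  induction n with
  | zero => simp
  | succ n ih =>
    rw [Polynomial.hermite_succ (n + 1), Polynomial.derivative_sub, Polynomial.derivative_mul,
      ih, Polynomial.derivative_mul, Polynomial.derivative_X, Polynomial.derivative_natCast,
      Polynomial.hermite_succ n]
    push_cast
    ring

theorem integral_hermite_succ_mul_aeval (n : ℕ) (q : Polynomial ℤ) :
    ∫ x : ℝ, (Polynomial.aeval x (Polynomial.hermite (n + 1)) : ℝ) *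
        Polynomial.aeval x q ∂(gaussianReal 0 1) =
      ∫ x : ℝ, (Polynomial.aeval x (Polynomial.hermite n) : ℝ) *
        Polynomial.aeval x (Polynomial.derivative q) ∂(gaussianReal 0 1) := by
  have h := integral_mul_aeval_gaussianReal_zero_one (Polynomial.hermite n * q)
  have hX := integrable_aeval_gaussianReal 0 1 (Polynomial.X * (Polynomial.hermite n * q))
  have hd := integrable_aeval_gaussianReal 0 1
    (Polynomial.derivative (Polynomial.hermite n) * q)
  have hq := integrable_aeval_gaussianReal 0 1
    (Polynomial.hermite n * Polynomial.derivative q)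
  simp only [Polynomial.derivative_mul, map_add, map_mul, Polynomial.aeval_X] at h hX hd hq
  rw [integral_add hd hq] at h
  simp only [Polynomial.hermite_succ, map_sub, map_mul, Polynomial.aeval_X, sub_mul, mul_assoc]
  rw [integral_sub hX hd, h, add_sub_cancel_left]

/-- Orthogonality of the probabilists' Hermite polynomials with respect to the
standard Gaussian measure: `∫ H_k H_m dγ = δ_{km} k!`. -/
theorem hermite_orthogonality (k m : ℕ) :
    ∫ x : ℝ, (Polynomial.aeval x (Polynomial.hermite k) : ℝ) *
        (Polynomial.aeval x (Polynomial.hermite m)) ∂(gaussianReal 0 1) =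
      if k = m then (Nat.factorial k : ℝ) else 0 := by
  induction k generalizing m with
  | zero =>
    cases m with
    | zero => simp
    | succ m => simpa using integral_hermite_succ_mul_aeval m 1
  | succ k ih =>
    rw [integral_hermite_succ_mul_aeval]
    cases m with
    | zero => simp
    | succ m =>
      simp only [derivative_hermite_succ, map_mul, map_natCast, mul_left_comm _ ((m + 1 : ℕ) : ℝ)]
      rw [integral_const_mul, ih]
      by_cases h : k = m <;> simp [h, Nat.factorial_succ]
end

section
/- For every integer ℓ ≥ 1 and every ε ∈ (0, 1] there exists a constant C > 0 such that for every n ∈ ℤ², Σ_{(n₁,…,n_ℓ) ∈ (ℤ²)^ℓ : n₁+⋯+n_ℓ = n} Π_{j=1}^{ℓ} (1 + |n_j|²)^{−1} ≤ C · (1 + |n|²)^{(−2+ε)/2}. In particular the sum on the left-hand side converges. -/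
open scoped BigOperators

/-- The squared Japanese bracket `⟨n⟩² = 1 + |n|²` on `ℤ²`. -/
noncomputable def bracketSq (n : ℤ × ℤ) : ℝ := 1 + (n.1 : ℝ) ^ 2 + (n.2 : ℝ) ^ 2

lemma one_le_bracketSq (n : ℤ × ℤ) : 1 ≤ bracketSq n := by
  unfold bracketSq; nlinarith [sq_nonneg (n.1 : ℝ), sq_nonneg (n.2 : ℝ)]

lemma bracketSq_pos (n : ℤ × ℤ) : 0 < bracketSq n :=
  one_pos.trans_le (one_le_bracketSq n)

lemma summable_one_add_int_sq_rpow {s : ℝ} (hs : 1 < s) :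
    Summable fun a : ℤ => (1 + (a : ℝ) ^ 2) ^ (-s / 2) := by
  refine Summable.of_norm_bounded_eventually (Real.summable_abs_int_rpow hs) ?_
  filter_upwards [(Set.finite_singleton (0 : ℤ)).compl_mem_cofinite] with a ha
  have ha : 0 < |(a : ℝ)| := abs_pos.2 (Int.cast_ne_zero.2 ha)
  rw [Real.norm_of_nonneg (by positivity)]
  calc (1 + (a : ℝ) ^ 2) ^ (-s / 2) ≤ (|(a : ℝ)| ^ (2 : ℝ)) ^ (-s / 2) := by
        refine Real.rpow_le_rpow_of_nonpos (by positivity) ?_ (by linarith)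
        rw [Real.rpow_two, sq_abs]
        linarith
    _ = |(a : ℝ)| ^ (-s) := by
        rw [← Real.rpow_mul ha.le]
        congr 1
        ring

lemma summable_bracketSq_rpow {s : ℝ} (hs : 1 < s) :
    Summable fun n : ℤ × ℤ => bracketSq n ^ (-s) := by
  have h := summable_one_add_int_sq_rpow hs
  refine Summable.of_nonneg_of_le (fun n => Real.rpow_nonneg (bracketSq_pos n).le _) (fun n => ?_)
    (h.mul_of_nonneg h (fun _ => by positivity) (fun _ => by positivity))
  rw [← Real.mul_rpow (by positivity) (by positivity)]
  calc bracketSq n ^ (-s) = (bracketSq n ^ (2 : ℝ)) ^ (-s / 2) := by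
        rw [← Real.rpow_mul (bracketSq_pos n).le]
        congr 1
        ring
    _ ≤ _ := by
        refine Real.rpow_le_rpow_of_nonpos (by positivity) ?_ (by linarith)
        rw [Real.rpow_two, bracketSq]
        nlinarith [sq_nonneg (n.1 : ℝ), sq_nonneg (n.2 : ℝ),
          mul_nonneg (sq_nonneg (n.1 : ℝ)) (sq_nonneg (n.2 : ℝ))]

lemma bracketSq_sum_le {d : ℕ} (m : Fin (d + 1) → ℤ × ℤ) (k : Fin (d + 1))
    (hk : ∀ j, bracketSq (m j) ≤ bracketSq (m k)) :
    bracketSq (∑ j, m j) ≤ ((d : ℝ) + 1) ^ 2 * bracketSq (m k) := by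
  have h₁ := sq_sum_le_card_mul_sum_sq (s := Finset.univ) (f := fun j => ((m j).1 : ℝ))
  have h₂ := sq_sum_le_card_mul_sum_sq (s := Finset.univ) (f := fun j => ((m j).2 : ℝ))
  have h₃ : ∑ j, bracketSq (m j) ≤ ((d : ℝ) + 1) * bracketSq (m k) := by
    simpa using Finset.sum_le_card_nsmul Finset.univ _ _ (fun j _ => hk j)
  simp only [bracketSq, Finset.sum_add_distrib, Finset.sum_const, Finset.card_univ,
    Fintype.card_fin, nsmul_eq_mul, mul_one, Nat.cast_add, Nat.cast_one, Prod.fst_sum,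
    Prod.snd_sum, Int.cast_sum] at h₁ h₂ h₃ ⊢
  have hd : (0 : ℝ) ≤ d := d.cast_nonneg
  nlinarith [mul_le_mul_of_nonneg_left h₃ (by linarith : (0 : ℝ) ≤ d + 1)]

/-- A tuple with prescribed sum is determined by all its entries but one, so summing a product
over the remaining entries is controlled by a power of the one-variable sum. -/
lemma sum_prod_succAbove_le {α : Type*} [AddCommGroup α] [DecidableEq α] {d : ℕ} {g : α → ℝ}
    (hg : ∀ a, 0 ≤ g a) {M : ℝ} (hM : ∀ t : Finset α, ∑ a ∈ t, g a ≤ M)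
    (k : Fin (d + 1)) (n : α) (u : Finset (Fin (d + 1) → α)) (hu : ∀ m ∈ u, ∑ j, m j = n) :
    ∑ m ∈ u, ∏ i, g (m (k.succAbove i)) ≤ M ^ d := by
  set r : (Fin (d + 1) → α) → Fin d → α := fun m i => m (k.succAbove i)
  have hinj : Set.InjOn r u := by
    intro m hm m' hm' h
    have h' : ∀ i, m (k.succAbove i) = m' (k.succAbove i) := fun i => congrFun h i
    have hs := (hu m hm).trans (hu m' hm').symm
    rw [Fin.sum_univ_succAbove _ k, Fin.sum_univ_succAbove _ k,
      Finset.sum_congr rfl fun i _ => h' i, add_left_inj] at hs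
    funext j
    rcases Fin.eq_self_or_eq_succAbove k j with rfl | ⟨i, rfl⟩
    exacts [hs, h' i]
  set t : Fin d → Finset α := fun i => u.image fun m => r m i
  calc ∑ m ∈ u, ∏ i, g (m (k.succAbove i)) = ∑ p ∈ u.image r, ∏ i, g (p i) :=
        (Finset.sum_image (f := fun p => ∏ i, g (p i)) hinj).symm
    _ ≤ ∑ p ∈ Fintype.piFinset t, ∏ i, g (p i) := by
        refine Finset.sum_le_sum_of_subset_of_nonneg ?_
          fun p _ _ => Finset.prod_nonneg fun i _ => hg _
        intro p hp
        obtain ⟨m, hm, rfl⟩ := Finset.mem_image.1 hp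
        exact Fintype.mem_piFinset.2 fun i => Finset.mem_image_of_mem (fun m => r m i) hm
    _ = ∏ i, ∑ a ∈ t i, g a := (Finset.prod_univ_sum t fun _ a => g a).symm
    _ ≤ ∏ _i : Fin d, M :=
        Finset.prod_le_prod (fun i _ => Finset.sum_nonneg fun a _ => hg a) fun i _ => hM _
    _ = M ^ d := by simp

/-- Pointwise bound: the largest factor carries the decay in the sum of the entries, and gives up
a small power to improve the decay of the other factors. -/
lemma prod_inv_bracketSq_le {d : ℕ} {θ δ : ℝ} (hθ : 0 ≤ θ) (hδ : 0 ≤ δ) (hθδ : d * δ ≤ 1 - θ)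
    (m : Fin (d + 1) → ℤ × ℤ) :
    ∏ j, (bracketSq (m j))⁻¹ ≤ (((d : ℝ) + 1) ^ 2) ^ θ * bracketSq (∑ j, m j) ^ (-θ) *
      ∑ k, ∏ i, bracketSq (m (Fin.succAbove k i)) ^ (-(1 + δ)) := by
  obtain ⟨k, hk⟩ := Finite.exists_max fun j => bracketSq (m j)
  have hpos := fun j => bracketSq_pos (m j)
  have hdecay : bracketSq (m k) ^ (-θ) ≤
      (((d : ℝ) + 1) ^ 2) ^ θ * bracketSq (∑ j, m j) ^ (-θ) := by
    rw [Real.rpow_neg (hpos k).le, Real.rpow_neg (bracketSq_pos _).le, ← div_eq_mul_inv,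
      inv_eq_one_div, div_le_div_iff₀ (Real.rpow_pos_of_pos (hpos k) _)
        (Real.rpow_pos_of_pos (bracketSq_pos _) _), one_mul,
      ← Real.mul_rpow (by positivity) (hpos k).le]
    exact Real.rpow_le_rpow (bracketSq_pos _).le (bracketSq_sum_le m k hk) hθ
  have hgain : bracketSq (m k) ^ (-(1 - θ)) ≤ ∏ i, bracketSq (m (k.succAbove i)) ^ (-δ) := by
    calc bracketSq (m k) ^ (-(1 - θ)) ≤ bracketSq (m k) ^ (-δ * d) :=
          Real.rpow_le_rpow_of_exponent_le (one_le_bracketSq _) (by linarith)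
      _ = ∏ _i : Fin d, bracketSq (m k) ^ (-δ) := by
          rw [Real.rpow_mul (hpos k).le, Real.rpow_natCast]; simp
      _ ≤ _ := Finset.prod_le_prod (fun i _ => Real.rpow_nonneg (hpos k).le _) fun i _ =>
          Real.rpow_le_rpow_of_nonpos (hpos _) (hk _) (by linarith)
  have hP : ∀ k, 0 ≤ ∏ i, bracketSq (m (Fin.succAbove k i)) ^ (-(1 + δ)) := fun k =>
    Finset.prod_nonneg fun i _ => Real.rpow_nonneg (hpos _).le _
  calc ∏ j, (bracketSq (m j))⁻¹
      = bracketSq (m k) ^ (-θ) * (bracketSq (m k) ^ (-(1 - θ)) *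
          ∏ i, (bracketSq (m (k.succAbove i)))⁻¹) := by
        rw [Fin.prod_univ_succAbove _ k, ← mul_assoc, ← Real.rpow_add (hpos k),
          ← Real.rpow_neg_one]
        congr 2
        ring
    _ ≤ bracketSq (m k) ^ (-θ) * ((∏ i, bracketSq (m (k.succAbove i)) ^ (-δ)) *
          ∏ i, (bracketSq (m (k.succAbove i)))⁻¹) := by
        refine mul_le_mul_of_nonneg_left (mul_le_mul_of_nonneg_right hgain ?_)
          (Real.rpow_nonneg (hpos k).le _)
        exact Finset.prod_nonneg fun i _ => inv_nonneg.2 (hpos _).le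
    _ = bracketSq (m k) ^ (-θ) * ∏ i, bracketSq (m (k.succAbove i)) ^ (-(1 + δ)) := by
        rw [← Finset.prod_mul_distrib]
        congr 1
        refine Finset.prod_congr rfl fun i _ => ?_
        rw [← Real.rpow_neg_one, ← Real.rpow_add (hpos _)]
        congr 1
        ring
    _ ≤ _ := mul_le_mul hdecay (Finset.single_le_sum
          (f := fun k => ∏ i, bracketSq (m (Fin.succAbove k i)) ^ (-(1 + δ)))
          (fun k _ => hP k) (Finset.mem_univ k)) (hP k)
        (mul_nonneg (by positivity) (Real.rpow_nonneg (bracketSq_pos _).le _))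

/-- Convolution estimate on `ℤ²`: for `ℓ ≥ 1` and `0 < ε ≤ 1`,
`Σ_{n₁+⋯+n_ℓ = n} Π_j ⟨n_j⟩^{-2} ≲ ⟨n⟩^{-2+ε}`; in particular the sum converges. -/
theorem lattice_convolution_estimate (ℓ : ℕ) (hℓ : 1 ≤ ℓ) (ε : ℝ)
    (hε1 : 0 < ε) (hε2 : ε ≤ 1) :
    ∃ C > (0 : ℝ), ∀ n : ℤ × ℤ,
      Summable (fun m : Fin ℓ → ℤ × ℤ =>
        if (∑ j, m j) = n then
          ∏ j, (1 + ((m j).1 : ℝ) ^ 2 + ((m j).2 : ℝ) ^ 2)⁻¹ else 0) ∧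
      (∑' m : Fin ℓ → ℤ × ℤ,
        if (∑ j, m j) = n then
          ∏ j, (1 + ((m j).1 : ℝ) ^ 2 + ((m j).2 : ℝ) ^ 2)⁻¹ else 0) ≤
        C * (1 + (n.1 : ℝ) ^ 2 + (n.2 : ℝ) ^ 2) ^ ((-2 + ε) / 2) := by
  obtain ⟨d, rfl⟩ : ∃ d, ℓ = d + 1 := ⟨ℓ - 1, by omega⟩
  simp only [← bracketSq.eq_1]
  set δ : ℝ := ε / 2 / (d + 1)
  set θ : ℝ := 1 - ε / 2
  have hδ : 0 < δ := by positivity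
  have hθ : 0 ≤ θ := by simp only [θ]; linarith
  have hθδ : d * δ ≤ 1 - θ := by
    have : ((d : ℝ) + 1) * δ = ε / 2 := by simp only [δ]; field_simp
    simp only [θ]; linarith
  set g : ℤ × ℤ → ℝ := fun a => bracketSq a ^ (-(1 + δ))
  have hg : ∀ a, 0 < g a := fun a => Real.rpow_pos_of_pos (bracketSq_pos a) _
  have hsum : Summable g := summable_bracketSq_rpow (by linarith)
  have hM : 0 < ∑' a, g a := hsum.tsum_pos (fun a => (hg a).le) 0 (hg 0)
  refine ⟨(((d : ℝ) + 1) ^ 2) ^ θ * ((d + 1) * (∑' a, g a) ^ d), by positivity, fun n => ?_⟩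
  set F : (Fin (d + 1) → ℤ × ℤ) → ℝ :=
    fun m => if ∑ j, m j = n then ∏ j, (bracketSq (m j))⁻¹ else 0
  have hF : ∀ m, 0 ≤ F m := fun m => by
    simp only [F]
    split_ifs
    exacts [Finset.prod_nonneg fun j _ => inv_nonneg.2 (bracketSq_pos _).le, le_rfl]
  have hbound : ∀ u : Finset (Fin (d + 1) → ℤ × ℤ), ∑ m ∈ u, F m ≤
      (((d : ℝ) + 1) ^ 2) ^ θ * ((d + 1) * (∑' a, g a) ^ d) *
        bracketSq n ^ ((-2 + ε) / 2) := by
    intro u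
    have hθε : (-2 + ε) / 2 = -θ := by simp only [θ]; ring
    rw [hθε]
    calc ∑ m ∈ u, F m = ∑ m ∈ u with ∑ j, m j = n, ∏ j, (bracketSq (m j))⁻¹ :=
          (Finset.sum_filter _ _).symm
      _ ≤ ∑ m ∈ u with ∑ j, m j = n, (((d : ℝ) + 1) ^ 2) ^ θ * bracketSq n ^ (-θ) *
            ∑ k, ∏ i, g (m (Fin.succAbove k i)) := by
          refine Finset.sum_le_sum fun m hm => ?_
          rw [← (Finset.mem_filter.1 hm).2]
          exact prod_inv_bracketSq_le hθ hδ.le hθδ m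
      _ = (((d : ℝ) + 1) ^ 2) ^ θ * bracketSq n ^ (-θ) *
            ∑ k, ∑ m ∈ u with ∑ j, m j = n, ∏ i, g (m (Fin.succAbove k i)) := by
          rw [← Finset.mul_sum, Finset.sum_comm]
      _ ≤ (((d : ℝ) + 1) ^ 2) ^ θ * bracketSq n ^ (-θ) *
            ∑ _k : Fin (d + 1), (∑' a, g a) ^ d := by
          refine mul_le_mul_of_nonneg_left (Finset.sum_le_sum fun k _ => ?_)
            (mul_nonneg (by positivity) (Real.rpow_nonneg (bracketSq_pos _).le _))
          exact sum_prod_succAbove_le (fun a => (hg a).le)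
            (fun t => hsum.sum_le_tsum t fun a _ => (hg a).le) k n _
            fun m hm => (Finset.mem_filter.1 hm).2
      _ = _ := by
          simp only [Finset.sum_const, Finset.card_univ, Fintype.card_fin, nsmul_eq_mul]
          push_cast
          ring
  have hFsum : Summable F := summable_of_sum_le hF hbound
  exact ⟨hFsum, hFsum.tsum_le_of_sum_le hbound⟩
end
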